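/- Let θ be a real antisymmetric 4 × 4 matrix and let T = {z ∈ ℂ⁴ : −Im z₀ > |Im z⃗|}. For every (z, w) ∈ T × T the function (k, p) ↦ e^{−i ω(k) z₀ + i⟨k, z⃗⟩} e^{−i ω(p) w₀ + i⟨p, w⃗⟩} e^{−i⟨p̃, θ k̃⟩} / (4 ω(k) ω(p)), with on-shell momenta k̃ = (ω(k), k) and p̃ = (ω(p), p), is Lebesgue integrable on ℝ³ × ℝ³, and the function f₂^θ(z, w) = (2π)^{−6} ∫_{ℝ³×ℝ³} e^{−i ω(k) z₀ + i⟨k, z⃗⟩} e^{−i ω(p) w₀ + i⟨p, w⃗⟩} e^{−i⟨p̃, θ k̃⟩} / (4 ω(k) ω(p)) dk dp is holomorphic on the open set T × T ⊆ ℂ⁸. -/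

import Mathlib

open MeasureTheory

/-- The on-shell energy `ω(k) = √(|k|² + m²)` for `k ∈ ℝ³`. -/
noncomputable def omega (m : ℝ) (k : Fin 3 → ℝ) : ℝ :=
  Real.sqrt ((∑ i, k i ^ 2) + m ^ 2)

/-- The on-shell four-momentum `k̃ = (ω(k), k) ∈ ℝ⁴`. -/
noncomputable def onShell (m : ℝ) (k : Fin 3 → ℝ) : Fin 4 → ℝ :=
  ![omega m k, k 0, k 1, k 2]

/-- The on-shell twisting pairing `⟨p̃, θ k̃⟩ = p̃ · (θ k̃)`. -/
noncomputable def twist (m : ℝ) (θ : Matrix (Fin 4) (Fin 4) ℝ) (k p : Fin 3 → ℝ) : ℝ :=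
  ∑ i : Fin 4, onShell m p i * ∑ j : Fin 4, θ i j * onShell m k j

/-- The tube `T = ℝ⁴ − iΓ₊ = {z = (z₀, z⃗) ∈ ℂ × ℂ³ : −Im z₀ > |Im z⃗|}`. -/
noncomputable def tube : Set (ℂ × (Fin 3 → ℂ)) :=
  {z | Real.sqrt (∑ i, (z.2 i).im ^ 2) < -z.1.im}

/-- The analytic function `f₂^θ(z, w)` whose boundary value is the twisted tensor
product `Δ₊^{(⋆2)}`. -/
noncomputable def f₂θAna (m : ℝ) (θ : Matrix (Fin 4) (Fin 4) ℝ)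
    (z w : ℂ × (Fin 3 → ℂ)) : ℂ :=
  ((((2 * Real.pi) ^ 6)⁻¹ : ℝ) : ℂ) *
    ∫ kp : (Fin 3 → ℝ) × (Fin 3 → ℝ),
      Complex.exp (-Complex.I * (omega m kp.1 : ℂ) * z.1 +
          Complex.I * ∑ i, (kp.1 i : ℂ) * z.2 i) *
        Complex.exp (-Complex.I * (omega m kp.2 : ℂ) * w.1 +
          Complex.I * ∑ i, (kp.2 i : ℂ) * w.2 i) *
        Complex.exp (-Complex.I * ((twist m θ kp.1 kp.2 : ℝ) : ℂ)) /
        (4 * (omega m kp.1 : ℂ) * (omega m kp.2 : ℂ))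

open Topology

theorem omega_pos {m : ℝ} (hm : 0 < m) (k : Fin 3 → ℝ) : 0 < omega m k :=
  Real.sqrt_pos.mpr (add_pos_of_nonneg_of_pos (Finset.sum_nonneg fun _ _ => sq_nonneg _)
    (pow_pos hm 2))

theorem le_omega (m : ℝ) (k : Fin 3 → ℝ) : m ≤ omega m k :=
  Real.le_sqrt_of_sq_le (le_add_of_nonneg_left (Finset.sum_nonneg fun _ _ => sq_nonneg _))

theorem sqrt_sum_sq_le_omega (m : ℝ) (k : Fin 3 → ℝ) : √(∑ i, k i ^ 2) ≤ omega m k :=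
  Real.sqrt_le_sqrt (le_add_of_nonneg_right (sq_nonneg m))

theorem abs_apply_le_omega (m : ℝ) (k : Fin 3 → ℝ) (i : Fin 3) : |k i| ≤ omega m k :=
  (Real.abs_le_sqrt (Finset.single_le_sum (f := fun i => k i ^ 2)
    (fun _ _ => sq_nonneg _) (Finset.mem_univ i))).trans (sqrt_sum_sq_le_omega m k)

theorem continuous_omega (m : ℝ) : Continuous (omega m) := by
  unfold omega
  fun_prop

theorem continuous_onShell (m : ℝ) : Continuous (onShell m) := by
  have := continuous_omega m
  refine continuous_pi fun i => ?_
  fin_cases i <;> simp [onShell] <;> fun_prop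

theorem continuous_twist (m : ℝ) (θ : Matrix (Fin 4) (Fin 4) ℝ) :
    Continuous fun kp : (Fin 3 → ℝ) × (Fin 3 → ℝ) => twist m θ kp.1 kp.2 := by
  have := continuous_onShell m
  unfold twist
  fun_prop

theorem integrable_exp_neg_mul_abs {c : ℝ} (hc : 0 < c) :
    Integrable fun x : ℝ => Real.exp (-c * |x|) := by
  rw [← integrableOn_univ, ← Set.Iic_union_Ioi (a := (0 : ℝ))]
  refine IntegrableOn.union ?_ ?_
  · refine (integrableOn_exp_mul_Iic hc 0).congr_fun (fun x hx => ?_) measurableSet_Iic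
    simp [abs_of_nonpos hx.out]
  · refine (integrableOn_exp_mul_Ioi (neg_lt_zero.mpr hc) 0).congr_fun (fun x hx => ?_)
      measurableSet_Ioi
    simp [abs_of_pos hx.out]

theorem integrable_exp_neg_mul_omega (m : ℝ) {δ : ℝ} (hδ : 0 < δ) :
    Integrable fun k : Fin 3 → ℝ => Real.exp (-δ * omega m k) := by
  have hω := continuous_omega m
  have h : Integrable fun k : Fin 3 → ℝ => ∏ i, Real.exp (-(δ / 3) * |k i|) :=
    Integrable.fintype_prod (f := fun _ : Fin 3 => fun x : ℝ => Real.exp (-(δ / 3) * |x|))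
      fun _ => integrable_exp_neg_mul_abs (by positivity)
  refine h.mono' (by fun_prop) (.of_forall fun k => ?_)
  rw [Real.norm_of_nonneg (Real.exp_nonneg _), ← Real.exp_sum, Real.exp_le_exp,
    Fin.sum_univ_three]
  nlinarith [abs_apply_le_omega m k 0, abs_apply_le_omega m k 1, abs_apply_le_omega m k 2]

/-- The gap `-Im z₀ - |Im z⃗|`, positive exactly on the tube. -/
noncomputable def tubeGap (z : ℂ × (Fin 3 → ℂ)) : ℝ :=
  -z.1.im - √(∑ i, (z.2 i).im ^ 2)

theorem mem_tube_iff {z : ℂ × (Fin 3 → ℂ)} : z ∈ tube ↔ 0 < tubeGap z :=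
  (sub_pos (a := -z.1.im) (b := √(∑ i, (z.2 i).im ^ 2))).symm

theorem continuous_tubeGap : Continuous tubeGap := by
  unfold tubeGap
  fun_prop

/-- The complex-linear phase `z ↦ -i ω(k) z₀ + i ⟨k, z⃗⟩`. -/
noncomputable def phase (m : ℝ) (k : Fin 3 → ℝ) : (ℂ × (Fin 3 → ℂ)) →L[ℂ] ℂ :=
  (-Complex.I * (omega m k : ℂ)) • ContinuousLinearMap.fst ℂ ℂ (Fin 3 → ℂ) +
    ∑ i, (Complex.I * (k i : ℂ)) •
      (ContinuousLinearMap.proj (R := ℂ) (φ := fun _ : Fin 3 => ℂ) i).comp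
        (ContinuousLinearMap.snd ℂ ℂ (Fin 3 → ℂ))

theorem phase_apply (m : ℝ) (k : Fin 3 → ℝ) (z : ℂ × (Fin 3 → ℂ)) :
    phase m k z = -Complex.I * (omega m k : ℂ) * z.1 + Complex.I * ∑ i, (k i : ℂ) * z.2 i := by
  simp [phase, Finset.mul_sum, mul_assoc]

theorem continuous_phase (m : ℝ) : Continuous (phase m) := by
  have := continuous_omega m
  unfold phase
  fun_prop

theorem norm_phase_le (m : ℝ) (k : Fin 3 → ℝ) : ‖phase m k‖ ≤ 4 * omega m k := by
  have h0 : 0 ≤ omega m k := Real.sqrt_nonneg _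
  refine ContinuousLinearMap.opNorm_le_bound _ (by positivity) fun z => ?_
  have h1 : ‖z.1‖ ≤ ‖z‖ := norm_fst_le z
  have h2 (i : Fin 3) : ‖z.2 i‖ ≤ ‖z‖ := (norm_le_pi_norm z.2 i).trans (norm_snd_le z)
  have h3 (i : Fin 3) : ‖(k i : ℂ) * z.2 i‖ ≤ omega m k * ‖z‖ := by
    rw [norm_mul, Complex.norm_real, Real.norm_eq_abs]
    exact mul_le_mul (abs_apply_le_omega m k i) (h2 i) (norm_nonneg _) h0
  calc ‖phase m k z‖ ≤ omega m k * ‖z.1‖ + ∑ i, ‖(k i : ℂ) * z.2 i‖ := by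
        rw [phase_apply]
        refine (norm_add_le _ _).trans (add_le_add ?_ ?_)
        · simp [abs_of_nonneg h0]
        · rw [norm_mul, Complex.norm_I, one_mul]
          exact norm_sum_le _ _
    _ ≤ omega m k * ‖z‖ + ∑ _i : Fin 3, omega m k * ‖z‖ :=
        add_le_add (mul_le_mul_of_nonneg_left h1 h0) (Finset.sum_le_sum fun i _ => h3 i)
    _ = 4 * omega m k * ‖z‖ := by simp; ring

theorem re_phase_le (m : ℝ) (k : Fin 3 → ℝ) (z : ℂ × (Fin 3 → ℂ)) :
    (phase m k z).re ≤ -tubeGap z * omega m k := by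
  have h1 : (phase m k z).re = omega m k * z.1.im + ∑ i, (-k i) * (z.2 i).im := by
    simp [phase_apply, Finset.sum_neg_distrib]
  have h2 := Real.sum_mul_le_sqrt_mul_sqrt Finset.univ (fun i => -k i) fun i => (z.2 i).im
  simp only [neg_sq] at h2
  have h3 := mul_le_mul_of_nonneg_right (sqrt_sum_sq_le_omega m k)
    (Real.sqrt_nonneg (∑ i, (z.2 i).im ^ 2))
  rw [h1, tubeGap]
  linarith

/-- The complex-linear phase in both variables. -/
noncomputable def phase₂ (m : ℝ) (kp : (Fin 3 → ℝ) × (Fin 3 → ℝ)) :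
    ((ℂ × (Fin 3 → ℂ)) × (ℂ × (Fin 3 → ℂ))) →L[ℂ] ℂ :=
  (phase m kp.1).comp (ContinuousLinearMap.fst ℂ _ _) +
    (phase m kp.2).comp (ContinuousLinearMap.snd ℂ _ _)

theorem continuous_phase₂ (m : ℝ) : Continuous (phase₂ m) := by
  have := continuous_phase m
  unfold phase₂
  fun_prop

theorem norm_phase₂_le (m : ℝ) (kp : (Fin 3 → ℝ) × (Fin 3 → ℝ)) :
    ‖phase₂ m kp‖ ≤ 4 * (omega m kp.1 + omega m kp.2) := by
  refine ContinuousLinearMap.opNorm_le_bound _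
    (mul_nonneg zero_le_four (add_nonneg (Real.sqrt_nonneg _) (Real.sqrt_nonneg _))) fun z => ?_
  have h1 := (phase m kp.1).le_of_opNorm_le_of_le (norm_phase_le m kp.1) (norm_fst_le z)
  have h2 := (phase m kp.2).le_of_opNorm_le_of_le (norm_phase_le m kp.2) (norm_snd_le z)
  calc ‖phase₂ m kp z‖ ≤ ‖phase m kp.1 z.1‖ + ‖phase m kp.2 z.2‖ := norm_add_le _ _
    _ ≤ _ := by linarith

/-- The momentum-space weight `e^{-i⟨p̃, θ k̃⟩} / (4 ω(k) ω(p))`. -/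
noncomputable def twistWeight (m : ℝ) (θ : Matrix (Fin 4) (Fin 4) ℝ)
    (kp : (Fin 3 → ℝ) × (Fin 3 → ℝ)) : ℂ :=
  Complex.exp (-Complex.I * ((twist m θ kp.1 kp.2 : ℝ) : ℂ)) /
    (4 * (omega m kp.1 : ℂ) * (omega m kp.2 : ℂ))

theorem continuous_twistWeight {m : ℝ} (hm : 0 < m) (θ : Matrix (Fin 4) (Fin 4) ℝ) :
    Continuous (twistWeight m θ) := by
  have h1 := continuous_omega m
  have h2 := continuous_twist m θ
  unfold twistWeight
  refine Continuous.div (by fun_prop) (by fun_prop) fun kp => ?_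
  simp [(omega_pos hm _).ne']

theorem norm_twistWeight_le {m : ℝ} (hm : 0 < m) (θ : Matrix (Fin 4) (Fin 4) ℝ)
    (kp : (Fin 3 → ℝ) × (Fin 3 → ℝ)) : ‖twistWeight m θ kp‖ ≤ 1 / (4 * m * m) := by
  have h1 := omega_pos hm kp.1
  have h2 := omega_pos hm kp.2
  have h3 := le_omega m kp.1
  have h4 := le_omega m kp.2
  rw [twistWeight, norm_div, Complex.norm_exp]
  simp only [norm_mul, Complex.norm_real, Real.norm_of_nonneg h1.le, Real.norm_of_nonneg h2.le]
  simp only [neg_mul, Complex.neg_re, Complex.I_mul_re, Complex.ofReal_im, neg_zero,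
    Real.exp_zero, Complex.norm_ofNat]
  gcongr

theorem integrand_eq (m : ℝ) (θ : Matrix (Fin 4) (Fin 4) ℝ)
    (zw : (ℂ × (Fin 3 → ℂ)) × (ℂ × (Fin 3 → ℂ))) (kp : (Fin 3 → ℝ) × (Fin 3 → ℝ)) :
    Complex.exp (-Complex.I * (omega m kp.1 : ℂ) * zw.1.1 +
          Complex.I * ∑ i, (kp.1 i : ℂ) * zw.1.2 i) *
        Complex.exp (-Complex.I * (omega m kp.2 : ℂ) * zw.2.1 +
          Complex.I * ∑ i, (kp.2 i : ℂ) * zw.2.2 i) *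
        Complex.exp (-Complex.I * ((twist m θ kp.1 kp.2 : ℝ) : ℂ)) /
        (4 * (omega m kp.1 : ℂ) * (omega m kp.2 : ℂ)) =
      twistWeight m θ kp * Complex.exp (phase₂ m kp zw) := by
  rw [← phase_apply, ← phase_apply, ← Complex.exp_add, twistWeight]
  simp only [phase₂, add_apply, ContinuousLinearMap.comp_apply,
    ContinuousLinearMap.coe_fst', ContinuousLinearMap.coe_snd']
  ring

theorem norm_exp_phase₂_le (m : ℝ) {δ : ℝ} {zw : (ℂ × (Fin 3 → ℂ)) × (ℂ × (Fin 3 → ℂ))}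
    (h₁ : δ ≤ tubeGap zw.1) (h₂ : δ ≤ tubeGap zw.2) (kp : (Fin 3 → ℝ) × (Fin 3 → ℝ)) :
    ‖Complex.exp (phase₂ m kp zw)‖ ≤ Real.exp (-δ * (omega m kp.1 + omega m kp.2)) := by
  rw [Complex.norm_exp, Real.exp_le_exp]
  have e : (phase₂ m kp zw).re = (phase m kp.1 zw.1).re + (phase m kp.2 zw.2).re := rfl
  have h3 := re_phase_le m kp.1 zw.1
  have h4 := re_phase_le m kp.2 zw.2
  have h5 : δ * omega m kp.1 ≤ tubeGap zw.1 * omega m kp.1 :=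
    mul_le_mul_of_nonneg_right h₁ (Real.sqrt_nonneg _)
  have h6 : δ * omega m kp.2 ≤ tubeGap zw.2 * omega m kp.2 :=
    mul_le_mul_of_nonneg_right h₂ (Real.sqrt_nonneg _)
  linarith

theorem integrable_exp_neg_mul_omega_add (m : ℝ) {δ : ℝ} (hδ : 0 < δ) :
    Integrable fun kp : (Fin 3 → ℝ) × (Fin 3 → ℝ) =>
      Real.exp (-δ * (omega m kp.1 + omega m kp.2)) := by
  have h := (integrable_exp_neg_mul_omega m hδ).mul_prod (integrable_exp_neg_mul_omega m hδ)
  simp only [← Real.exp_add, ← mul_add] at h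
  exact h

theorem mul_exp_neg_mul_le {δ : ℝ} (hδ : 0 < δ) (s : ℝ) :
    s * Real.exp (-δ * s) ≤ 2 / δ * Real.exp (-(δ / 2) * s) := by
  have h1 : s ≤ 2 / δ * Real.exp (δ / 2 * s) := by
    have h := Real.add_one_le_exp (δ / 2 * s)
    rw [div_mul_eq_mul_div, le_div_iff₀ hδ]
    linarith
  calc s * Real.exp (-δ * s) ≤ 2 / δ * Real.exp (δ / 2 * s) * Real.exp (-δ * s) := by gcongr
    _ = 2 / δ * Real.exp (-(δ / 2) * s) := by
      rw [mul_assoc, ← Real.exp_add]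
      ring_nf

theorem continuous_twistWeight_mul_exp {m : ℝ} (hm : 0 < m) (θ : Matrix (Fin 4) (Fin 4) ℝ)
    (zw : (ℂ × (Fin 3 → ℂ)) × (ℂ × (Fin 3 → ℂ))) :
    Continuous fun kp => twistWeight m θ kp * Complex.exp (phase₂ m kp zw) := by
  have h1 := continuous_twistWeight hm θ
  have h2 := continuous_phase₂ m
  fun_prop

theorem integrable_twistWeight_mul_exp {m : ℝ} (hm : 0 < m) (θ : Matrix (Fin 4) (Fin 4) ℝ)
    {zw : (ℂ × (Fin 3 → ℂ)) × (ℂ × (Fin 3 → ℂ))} (h : zw ∈ tube ×ˢ tube) :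
    Integrable fun kp => twistWeight m θ kp * Complex.exp (phase₂ m kp zw) := by
  have hδ : 0 < min (tubeGap zw.1) (tubeGap zw.2) :=
    lt_min (mem_tube_iff.mp h.1) (mem_tube_iff.mp h.2)
  refine ((integrable_exp_neg_mul_omega_add m hδ).const_mul (1 / (4 * m * m))).mono'
    (continuous_twistWeight_mul_exp hm θ zw).aestronglyMeasurable (.of_forall fun kp => ?_)
  rw [norm_mul]
  exact mul_le_mul (norm_twistWeight_le hm θ kp)
    (norm_exp_phase₂_le m (min_le_left _ _) (min_le_right _ _) kp) (norm_nonneg _) (by positivity)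

theorem differentiableAt_integral_twistWeight_mul_exp {m : ℝ} (hm : 0 < m)
    (θ : Matrix (Fin 4) (Fin 4) ℝ) {zw : (ℂ × (Fin 3 → ℂ)) × (ℂ × (Fin 3 → ℂ))}
    (h : zw ∈ tube ×ˢ tube) :
    DifferentiableAt ℂ
      (fun zw => ∫ kp, twistWeight m θ kp * Complex.exp (phase₂ m kp zw)) zw := by
  obtain ⟨δ, hδ, hlt⟩ := exists_between
    (lt_min (mem_tube_iff.mp h.1) (mem_tube_iff.mp h.2))
  rw [lt_min_iff] at hlt
  have hs : {x : (ℂ × (Fin 3 → ℂ)) × (ℂ × (Fin 3 → ℂ)) |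
      δ < tubeGap x.1 ∧ δ < tubeGap x.2} ∈ 𝓝 zw :=
    ((isOpen_lt continuous_const (continuous_tubeGap.comp continuous_fst)).inter
      (isOpen_lt continuous_const (continuous_tubeGap.comp continuous_snd))).mem_nhds hlt
  refine (hasFDerivAt_integral_of_dominated_of_fderiv_le (𝕜 := ℂ)
    (F' := fun x kp => (twistWeight m θ kp * Complex.exp (phase₂ m kp x)) • phase₂ m kp)
    (bound := fun kp => 1 / (4 * m * m) * (4 * (2 / δ)) *
      Real.exp (-(δ / 2) * (omega m kp.1 + omega m kp.2))) hs
    (.of_forall fun x => (continuous_twistWeight_mul_exp hm θ x).aestronglyMeasurable)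
    (integrable_twistWeight_mul_exp hm θ h)
    ((continuous_twistWeight_mul_exp hm θ zw).smul (continuous_phase₂ m)).aestronglyMeasurable
    (.of_forall fun kp x hx => ?_)
    ((integrable_exp_neg_mul_omega_add m (half_pos hδ)).const_mul _)
    (.of_forall fun kp x _ => ?_)).differentiableAt
  · rw [norm_smul, norm_mul]
    have hω : 0 ≤ omega m kp.1 + omega m kp.2 :=
      add_nonneg (Real.sqrt_nonneg _) (Real.sqrt_nonneg _)
    calc _ ≤ 1 / (4 * m * m) * Real.exp (-δ * (omega m kp.1 + omega m kp.2)) *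
          (4 * (omega m kp.1 + omega m kp.2)) := by
          gcongr
          · exact norm_twistWeight_le hm θ kp
          · exact norm_exp_phase₂_le m hx.1.le hx.2.le kp
          · exact norm_phase₂_le m kp
      _ = 1 / (4 * m * m) * 4 * ((omega m kp.1 + omega m kp.2) *
          Real.exp (-δ * (omega m kp.1 + omega m kp.2))) := by ring
      _ ≤ 1 / (4 * m * m) * 4 * (2 / δ *
          Real.exp (-(δ / 2) * (omega m kp.1 + omega m kp.2))) := by
          exact mul_le_mul_of_nonneg_left (mul_exp_neg_mul_le hδ _) (by positivity)
      _ = _ := by ring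
  · have h1 := ((phase₂ m kp).hasFDerivAt (x := x)).cexp.const_mul (twistWeight m θ kp)
    rwa [smul_smul] at h1

/-- For every `(z, w) ∈ T × T` the twisted integrand is Lebesgue integrable on
`ℝ³ × ℝ³`, and `f₂^θ` is holomorphic on the open set `T × T ⊆ ℂ⁸`. -/
theorem f₂θAna_integrable_and_holomorphic (m : ℝ) (hm : 0 < m)
    (θ : Matrix (Fin 4) (Fin 4) ℝ) (hθ : θ.transpose = -θ) :
    (∀ z ∈ tube, ∀ w ∈ tube, Integrable (fun kp : (Fin 3 → ℝ) × (Fin 3 → ℝ) =>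
      Complex.exp (-Complex.I * (omega m kp.1 : ℂ) * z.1 +
          Complex.I * ∑ i, (kp.1 i : ℂ) * z.2 i) *
        Complex.exp (-Complex.I * (omega m kp.2 : ℂ) * w.1 +
          Complex.I * ∑ i, (kp.2 i : ℂ) * w.2 i) *
        Complex.exp (-Complex.I * ((twist m θ kp.1 kp.2 : ℝ) : ℂ)) /
        (4 * (omega m kp.1 : ℂ) * (omega m kp.2 : ℂ)))) ∧
    DifferentiableOn ℂ (fun zw : (ℂ × (Fin 3 → ℂ)) × (ℂ × (Fin 3 → ℂ)) =>
      f₂θAna m θ zw.1 zw.2) (tube ×ˢ tube) := by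
  refine ⟨fun z hz w hw => ?_, fun zw h => ?_⟩
  · simpa only [integrand_eq m θ (z, w)] using
      integrable_twistWeight_mul_exp hm θ (zw := (z, w)) ⟨hz, hw⟩
  · simp only [f₂θAna, integrand_eq]
    exact ((differentiableAt_integral_twistWeight_mul_exp hm θ h).const_mul _).differentiableWithinAt
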